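/- Let n ≥ 3. On the Maxwell phase manifold of dimension 2n + n(n−1)/2, the n-form Λ = −*F ∧ dA + (1/2) F ∧ *F satisfies dΛ = θ ∧ ψ, where θ = dA − F is a 2-form and ψ = −d(*F) is an (n−1)-form; in particular the (n+1)-form θ ∧ ψ is closed. -/

import Mathlib

open scoped BigOperators

noncomputable section

namespace EDS

/-- Points of the model space `ℝ^ι` with coordinates indexed by `ι`. -/
abbrev Pt (ι : Type) : Type := ι → ℝ

/-- A differential `p`-form on `ℝ^ι`, represented by its (antisymmetric)
coefficient functions: `ω idx` is the coefficient `ω_{idx 0 … idx (p-1)}`. -/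
abbrev PForm (ι : Type) (p : ℕ) : Type := (Fin p → ι) → Pt ι → ℝ

variable {ι : Type} [Fintype ι] [DecidableEq ι]

/-- A `0`-form from a function. -/
def ofFun (f : Pt ι → ℝ) : PForm ι 0 := fun _ => f

/-- Partial derivative in the coordinate direction `u`. -/
def pd (u : ι) (f : Pt ι → ℝ) : Pt ι → ℝ :=
  fun x => fderiv ℝ f x (Pi.single u 1)

/-- Exterior derivative, in coefficient form:
`(dω)_{i₀…i_p} = Σ_k (-1)^k ∂_{i_k} ω_{i₀…î_k…i_p}`. -/
def extd {p : ℕ} (ω : PForm ι p) : PForm ι (p + 1) :=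
  fun idx x => ∑ k : Fin (p + 1), (-1 : ℝ) ^ (k : ℕ) * pd (idx k) (ω (idx ∘ k.succAbove)) x

/-- Wedge product, in coefficient form:
`(ω∧η)_{i₁…i_{p+q}} = (1/(p!q!)) Σ_{σ ∈ S_{p+q}} sgn σ · ω_{i_{σ(1)}…i_{σ(p)}} η_{i_{σ(p+1)}…i_{σ(p+q)}}`. -/
def wedge {p q : ℕ} (ω : PForm ι p) (η : PForm ι q) : PForm ι (p + q) :=
  fun idx x => ((p.factorial * q.factorial : ℕ) : ℝ)⁻¹ *
    ∑ σ : Equiv.Perm (Fin (p + q)), ((Equiv.Perm.sign σ : ℤ) : ℝ) *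
      (ω (fun i => idx (σ (Fin.castAdd q i))) x * η (fun j => idx (σ (Fin.natAdd p j))) x)

infixl:72 " ⋏ " => wedge

/-- Wedge product of a family of `1`-forms. -/
def wedgeFam {m : ℕ} (α : Fin m → PForm ι 1) : PForm ι m :=
  fun idx x => ∑ σ : Equiv.Perm (Fin m), ((Equiv.Perm.sign σ : ℤ) : ℝ) *
    ∏ t, α t (fun _ => idx (σ t)) x

/-- Multiplication of a `p`-form by a scalar function. -/
def fsmul (f : Pt ι → ℝ) {p : ℕ} (ω : PForm ι p) : PForm ι p := fun idx x => f x * ω idx x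

/-- Reinterpret a `p`-form as a `q`-form along a proof `p = q`. -/
def PForm.cast {p q : ℕ} (h : p = q) (ω : PForm ι p) : PForm ι q :=
  fun idx x => ω (fun i => idx (Fin.cast h i)) x

/-- The totally antisymmetric Levi-Civita symbol `ε`, with `ε(id) = 1`. -/
def eps {m : ℕ} (f : Fin m → Fin m) : ℝ :=
  if h : Function.Bijective f then ((Equiv.Perm.sign (Equiv.ofBijective f h) : ℤ) : ℝ) else 0

/-- The Lorentz (Minkowski) metric `η = diag(-1,1,…,1)` (diagonal entries). -/
def etaD {m : ℕ} (i : Fin m) : ℝ := if (i : ℕ) = 0 then -1 else 1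

/-- Assemble the index tuple `(i, j, k₁, …, k_{n-2})` as a map `Fin n → Fin n`. -/
def raiseIdx {n : ℕ} (i j : Fin n) (k : Fin (n - 2) → Fin n) : Fin n → Fin n :=
  fun t => if h0 : (t : ℕ) = 0 then i else if h1 : (t : ℕ) = 1 then j
    else k ⟨(t : ℕ) - 2, by have := t.isLt; omega⟩

/-! ### The Maxwell phase manifold in `n` spacetime dimensions -/

/-- Index type for the coordinates `A_i`, `F_{ij}` (`i < j`), `x^i` of the
Maxwell phase manifold of dimension `2n + n(n-1)/2`. -/
abbrev MC (n : ℕ) : Type := Fin n ⊕ ({p : Fin n × Fin n // p.1 < p.2} ⊕ Fin n)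

/-- The coordinate function `x^i`. -/
def xc (n : ℕ) (i : Fin n) : Pt (MC n) → ℝ := fun m => m (Sum.inr (Sum.inr i))

/-- The coordinate function `A_i`. -/
def Ac (n : ℕ) (i : Fin n) : Pt (MC n) → ℝ := fun m => m (Sum.inl i)

/-- The antisymmetric array `F_{ij} = -F_{ji}` built from the coordinates
`F_{ij}`, `i < j`. -/
def Fc (n : ℕ) (i j : Fin n) : Pt (MC n) → ℝ := fun m =>
  if h : i < j then m (Sum.inr (Sum.inl ⟨(i, j), h⟩))
  else if h' : j < i then - m (Sum.inr (Sum.inl ⟨(j, i), h'⟩)) else 0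

/-- The coordinate `1`-forms `dx^i`. -/
def dx (n : ℕ) (i : Fin n) : PForm (MC n) 1 := extd (ofFun (xc n i))

/-- The potential `1`-form `A = A_i dx^i`. -/
def Aform (n : ℕ) : PForm (MC n) 1 := ∑ i, fsmul (Ac n i) (dx n i)

/-- The field `2`-form `F = (1/2) F_{ij} dx^i ∧ dx^j`. -/
def Fform (n : ℕ) : PForm (MC n) 2 := (1/2 : ℝ) • ∑ i, ∑ j, fsmul (Fc n i j) (dx n i ⋏ dx n j)

/-- The dual field `(n-2)`-form
`*F = (1/(2(n-2)!)) F^{ij} ε_{ij}{}^{k₁…k_{n-2}} dx^{k₁} ∧ ⋯ ∧ dx^{k_{n-2}}`,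
indices raised with the Lorentz metric `η = diag(-1,1,…,1)`. -/
def starF (n : ℕ) : PForm (MC n) (n - 2) :=
  ((2 * (n - 2).factorial : ℕ) : ℝ)⁻¹ • ∑ i, ∑ j, ∑ k : Fin (n - 2) → Fin n,
    (etaD i * etaD j * (∏ t, etaD (k t)) * eps (raiseIdx i j k)) •
      fsmul (Fc n i j) (wedgeFam (fun t => dx n (k t)))

end EDS

open EDS

namespace EDSaux

set_option linter.unusedSectionVars false

variable {ι : Type} [Fintype ι] [DecidableEq ι]

/-- The exterior algebra used for bookkeeping. -/
abbrev EA (ι : Type) : Type := ExteriorAlgebra ℝ (ι → ℝ)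

/-- basis covector -/
def bv (u : ι) : ι → ℝ := Pi.single u 1

def ev (u : ι) : EA ι := ExteriorAlgebra.ι ℝ (bv u)

/-- basis multivector -/
def em {p : ℕ} (idx : Fin p → ι) : EA ι := ExteriorAlgebra.ιMulti ℝ p (fun t => bv (idx t))

/-- Coefficients to exterior algebra -/
def Psi {p : ℕ} (c : (Fin p → ι) → ℝ) : EA ι := ((p.factorial : ℝ))⁻¹ • ∑ idx, c idx • em idx

/-- antisymmetrisation -/
def alt {p : ℕ} (c : (Fin p → ι) → ℝ) : (Fin p → ι) → ℝ := fun idx =>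
  ∑ σ : Equiv.Perm (Fin p), ((Equiv.Perm.sign σ : ℤ) : ℝ) * c (fun t => idx (σ t))

def IsAlt {p : ℕ} (c : (Fin p → ι) → ℝ) : Prop :=
  ∀ (idx : Fin p → ι) (σ : Equiv.Perm (Fin p)),
    c (fun t => idx (σ t)) = ((Equiv.Perm.sign σ : ℤ) : ℝ) * c idx

lemma sgn_mul_self {p : ℕ} (σ : Equiv.Perm (Fin p)) :
    ((Equiv.Perm.sign σ : ℤ) : ℝ) * ((Equiv.Perm.sign σ : ℤ) : ℝ) = 1 := by
  rcases Int.units_eq_one_or (Equiv.Perm.sign σ) with h | h <;> simp [h]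

lemma em_perm {p : ℕ} (idx : Fin p → ι) (σ : Equiv.Perm (Fin p)) :
    em (fun t => idx (σ t)) = ((Equiv.Perm.sign σ : ℤ) : ℝ) • em idx := by
  have := (ExteriorAlgebra.ιMulti ℝ p).map_perm (fun t => bv (idx t)) σ
  unfold em
  refine Eq.trans this ?_
  rcases Int.units_eq_one_or (Equiv.Perm.sign σ) with h | h <;> simp [h]

lemma em_append {p q : ℕ} (i : Fin p → ι) (j : Fin q → ι) :
    em (Fin.append i j) = em i * em j := by
  unfold em
  rw [ExteriorAlgebra.ιMulti_mul_ιMulti]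
  congr 1
  ext t : 1
  refine Fin.addCases (fun a => ?_) (fun a => ?_) t <;> simp

lemma em_succ {p : ℕ} (i : Fin (p+1) → ι) :
    em i = ev (i 0) * em (fun t => i t.succ) := by
  unfold em ev
  rw [ExteriorAlgebra.ιMulti_succ_apply]
  rfl

lemma em_insertNth {p : ℕ} (k : Fin (p+1)) (u : ι) (j : Fin p → ι) :
    em (k.insertNth (α := fun _ => ι) u j) = (-1 : ℝ) ^ (k : ℕ) • (ev u * em j) := by
  have h := (ExteriorAlgebra.ιMulti ℝ (p+1)).map_insertNth k (bv u) (fun t => bv (j t))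
  have h2 : em (k.insertNth (α := fun _ => ι) u j) = ExteriorAlgebra.ιMulti ℝ (p+1)
      (k.insertNth (α := fun _ => ι → ℝ) (bv u) (fun t => bv (j t))) := by
    unfold em
    congr 1
    ext t : 1
    refine Fin.succAboveCases k ?_ (fun a => ?_) t <;> simp
  rw [h2, h, ExteriorAlgebra.ιMulti_succ_apply]
  rcases neg_one_pow_eq_or ℝ (k : ℕ) with h | h
  · rcases neg_one_pow_eq_or ℤ (k : ℕ) with h' | h'
    · simp [h', h]; rfl
    · exfalso
      have : (((-1 : ℤ) ^ (k : ℕ) : ℤ) : ℝ) = -1 := by rw [h']; simp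
      push_cast at this; rw [h] at this; norm_num at this
  · rcases neg_one_pow_eq_or ℤ (k : ℕ) with h' | h'
    · exfalso
      have : (((-1 : ℤ) ^ (k : ℕ) : ℤ) : ℝ) = 1 := by rw [h']; simp
      push_cast at this; rw [h] at this; norm_num at this
    · simp [h', h]; rfl

lemma Psi_add {p : ℕ} (c d : (Fin p → ι) → ℝ) :
    Psi (fun i => c i + d i) = Psi c + Psi d := by
  simp [Psi, add_smul, Finset.sum_add_distrib]

lemma Psi_smul {p : ℕ} (r : ℝ) (c : (Fin p → ι) → ℝ) :
    Psi (fun i => r * c i) = r • Psi c := by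
  simp only [Psi, mul_smul, ← Finset.smul_sum]
  rw [smul_comm]

lemma Psi_neg {p : ℕ} (c : (Fin p → ι) → ℝ) :
    Psi (fun i => - c i) = - Psi c := by
  simp [Psi]

lemma Psi_sub {p : ℕ} (c d : (Fin p → ι) → ℝ) :
    Psi (fun i => c i - d i) = Psi c - Psi d := by
  simp [Psi, sub_smul, Finset.sum_sub_distrib, smul_sub]

lemma Psi_zero {p : ℕ} : Psi (fun _ : Fin p → ι => (0:ℝ)) = 0 := by
  simp [Psi]

lemma Psi_sum {p : ℕ} {κ : Type} (s : Finset κ) (c : κ → (Fin p → ι) → ℝ) :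
    Psi (fun i => ∑ a ∈ s, c a i) = ∑ a ∈ s, Psi (c a) := by
  simp only [Psi, Finset.sum_smul, ← Finset.smul_sum]
  rw [Finset.sum_comm]

lemma Psi_alt {p : ℕ} (c : (Fin p → ι) → ℝ) : Psi (alt c) = ∑ idx, c idx • em idx := by
  unfold Psi alt
  simp only [Finset.sum_smul]
  rw [Finset.sum_comm]
  have : ∀ σ : Equiv.Perm (Fin p), ∑ idx : Fin p → ι,
      (((Equiv.Perm.sign σ : ℤ) : ℝ) * c (fun t => idx (σ t))) • em idx
      = ∑ idx, c idx • em idx := by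
    intro σ
    rw [← (Equiv.arrowCongr σ (Equiv.refl ι)).sum_comp
      (fun idx => (((Equiv.Perm.sign σ : ℤ) : ℝ) * c (fun t => idx (σ t))) • em idx)]
    refine Finset.sum_congr rfl fun idx _ => ?_
    have h1 := em_perm (fun t => idx (σ.symm t)) σ
    simp only [Equiv.symm_apply_apply] at h1
    have h2 : (Equiv.arrowCongr σ (Equiv.refl ι)) idx = fun t => idx (σ.symm t) := rfl
    rw [h2, h1]
    simp only [Equiv.symm_apply_apply, smul_smul]
    congr 1
    ring
  simp only [this, Finset.sum_const, Finset.card_univ, Fintype.card_perm, Fintype.card_fin]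
  rw [← Nat.cast_smul_eq_nsmul ℝ, smul_smul, inv_mul_cancel₀, one_smul]
  exact_mod_cast p.factorial_ne_zero

lemma Psi_mul {p q : ℕ} (c : (Fin p → ι) → ℝ) (d : (Fin q → ι) → ℝ) :
    Psi c * Psi d = ((p.factorial * q.factorial : ℕ) : ℝ)⁻¹ •
      Psi (alt (fun idx : Fin (p+q) → ι => c (fun i => idx (Fin.castAdd q i)) *
        d (fun j => idx (Fin.natAdd p j)))) := by
  rw [Psi_alt, ← (Fin.appendEquiv p q).sum_comp, Fintype.sum_prod_type]
  have : ∀ (i : Fin p → ι) (j : Fin q → ι), Fin.appendEquiv p q (i, j) = Fin.append i j :=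
    fun _ _ => rfl
  simp only [this, Fin.append_left, Fin.append_right, em_append]
  unfold Psi
  rw [smul_mul_smul_comm, Finset.sum_mul_sum]
  push_cast
  rw [mul_inv]
  simp only [smul_mul_smul_comm]

lemma Psi_cast {p q : ℕ} (h : p = q) (c : (Fin p → ι) → ℝ) :
    Psi (fun idx : Fin q → ι => c (fun i => idx (Fin.cast h i))) = Psi c := by
  subst h; rfl

/-- evaluation determinant -/
def dl {p : ℕ} (j i : Fin p → ι) : ℝ := Matrix.det (Matrix.of fun t s => bv (j t) (i s))

lemma dl_eq {p : ℕ} (j i : Fin p → ι) : dl j i = ∑ σ : Equiv.Perm (Fin p),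
    ((Equiv.Perm.sign σ : ℤ) : ℝ) * if j = (fun t => i (σ t)) then 1 else 0 := by
  unfold dl
  rw [← Matrix.det_transpose, Matrix.det_apply']
  refine Finset.sum_congr rfl fun σ _ => ?_
  congr 1
  split_ifs with h
  · subst h; simp [bv]
  · obtain ⟨t, ht⟩ := Function.ne_iff.1 h
    apply Finset.prod_eq_zero (Finset.mem_univ t)
    simp [bv, Pi.single_apply, Ne.symm ht]

lemma dl_alt {p : ℕ} (j : Fin p → ι) : IsAlt (dl j) := by
  intro i σ
  unfold dl
  have := Matrix.det_permute' σ (Matrix.of fun t s => bv (j t) (i s))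
  rw [← this]; rfl

lemma sum_dl {p : ℕ} (c : (Fin p → ι) → ℝ) (i : Fin p → ι) : ∑ j, c j * dl j i = alt c i := by
  simp only [dl_eq, Finset.mul_sum]
  rw [Finset.sum_comm]
  unfold alt
  refine Finset.sum_congr rfl fun σ _ => ?_
  rw [Finset.sum_eq_single (fun t => i (σ t))]
  · simp; ring
  · intro b _ hb; simp [hb]
  · simp

lemma alt_of_isAlt {p : ℕ} {c : (Fin p → ι) → ℝ} (h : IsAlt c) (i) :
    alt c i = p.factorial * c i := by
  unfold alt
  simp only [h i, ← mul_assoc, sgn_mul_self]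
  simp [Fintype.card_perm]

lemma isAlt_alt {p : ℕ} (c : (Fin p → ι) → ℝ) : IsAlt (alt c) := by
  intro idx σ
  simp only [← sum_dl, dl_alt _ _ σ, Finset.mul_sum]
  refine Finset.sum_congr rfl fun j _ => ?_
  ring

/-- coefficient extraction -/
def Dx {p : ℕ} (i : Fin p → ι) : EA ι →ₗ[ℝ] ℝ :=
  ExteriorAlgebra.liftAlternating (R := ℝ) (M := ι → ℝ) (N := ℝ) (fun q =>
    if h : q = p then
      (Matrix.detRowAlternating (R := ℝ) (n := Fin q)).compLinearMap
        (LinearMap.pi fun s : Fin q => LinearMap.proj (i (Fin.cast h s)))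
    else 0)

lemma Dx_em {p : ℕ} (i j : Fin p → ι) : Dx i (em j) = dl j i := by
  unfold Dx em
  rw [ExteriorAlgebra.liftAlternating_apply_ιMulti]
  simp only [dite_true]
  rfl

lemma Dx_Psi {p : ℕ} {c : (Fin p → ι) → ℝ} (h : IsAlt c) (i) : Dx i (Psi c) = c i := by
  unfold Psi
  simp only [map_smul, map_sum, Dx_em, smul_eq_mul]
  rw [sum_dl, alt_of_isAlt h, ← mul_assoc, inv_mul_cancel₀, one_mul]
  exact_mod_cast p.factorial_ne_zero

lemma Psi_inj {p : ℕ} {c d : (Fin p → ι) → ℝ} (hc : IsAlt c) (hd : IsAlt d)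
    (h : Psi c = Psi d) : c = d := by
  funext i
  rw [← Dx_Psi hc, h, Dx_Psi hd]

lemma IsAlt.smul {p : ℕ} {c : (Fin p → ι) → ℝ} (h : IsAlt c) (r : ℝ) :
    IsAlt (fun i => r * c i) := by
  intro i σ; simp only [h i σ]; ring

lemma IsAlt.add {p : ℕ} {c d : (Fin p → ι) → ℝ} (h : IsAlt c) (h' : IsAlt d) :
    IsAlt (fun i => c i + d i) := by
  intro i σ; simp only [h i σ, h' i σ]; ring

lemma IsAlt.neg {p : ℕ} {c : (Fin p → ι) → ℝ} (h : IsAlt c) :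
    IsAlt (fun i => - c i) := by
  intro i σ; simp only [h i σ]; ring

lemma IsAlt.cast {p q : ℕ} (e : p = q) {c : (Fin p → ι) → ℝ} (h : IsAlt c) :
    IsAlt (fun idx : Fin q → ι => c (fun i => idx (Fin.cast e i))) := by
  subst e; exact h

lemma ev_sq (u : ι) : ev u * ev u = 0 := ExteriorAlgebra.ι_sq_zero _

lemma ev_swap (u v : ι) : ev u * ev v = - (ev v * ev u) :=
  eq_neg_of_add_eq_zero_left (ExteriorAlgebra.ι_add_mul_swap _ _)

lemma ev_comm_two (u v w : ι) : (ev u * ev v) * ev w = ev w * (ev u * ev v) := by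
  rw [mul_assoc, ev_swap v w, mul_neg, ← mul_assoc, ev_swap u w, neg_mul, neg_neg, mul_assoc]

lemma Psi_two_ev (c : (Fin 2 → ι) → ℝ) (w : ι) : Psi c * ev w = ev w * Psi c := by
  unfold Psi
  rw [smul_mul_assoc, mul_smul_comm, Finset.sum_mul, Finset.mul_sum]
  congr 1
  refine Finset.sum_congr rfl fun i _ => ?_
  rw [smul_mul_assoc, mul_smul_comm]
  congr 1
  have : em i = ev (i 0) * ev (i 1) := by
    rw [em_succ, em_succ]; simp [em]
  rw [this, ev_comm_two]

lemma Psi_two_em (c : (Fin 2 → ι) → ℝ) : ∀ {q : ℕ} (j : Fin q → ι), Psi c * em j = em j * Psi c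
  | 0, j => by simp [em]
  | q+1, j => by
    rw [em_succ, ← mul_assoc, Psi_two_ev, mul_assoc, Psi_two_em c, mul_assoc]

lemma Psi_two_comm (c : (Fin 2 → ι) → ℝ) {q : ℕ} (d : (Fin q → ι) → ℝ) :
    Psi c * Psi d = Psi d * Psi c := by
  conv_lhs => rw [Psi.eq_def d]
  conv_rhs => rw [Psi.eq_def d]
  rw [smul_mul_assoc, mul_smul_comm, Finset.sum_mul, Finset.mul_sum]
  congr 1
  refine Finset.sum_congr rfl fun i _ => ?_
  rw [smul_mul_assoc, mul_smul_comm, Psi_two_em]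

open scoped ContDiff

/-- coefficientwise partial derivative -/
def pf (u : ι) {p : ℕ} (w : PForm ι p) : PForm ι p := fun idx => pd u (w idx)

def Sm {p : ℕ} (w : PForm ι p) : Prop := ∀ idx, ContDiff ℝ ∞ (w idx)

def AltF {p : ℕ} (w : PForm ι p) : Prop := ∀ x, IsAlt (fun idx => w idx x)

def P {p : ℕ} (w : PForm ι p) (x : Pt ι) : EA ι := Psi (fun idx => w idx x)

lemma pd_smooth {f : Pt ι → ℝ} (hf : ContDiff ℝ ∞ f) (u : ι) : ContDiff ℝ ∞ (pd u f) := by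
  unfold pd
  exact (hf.fderiv_right (m := ∞) (by simp)).clm_apply contDiff_const

lemma smooth_diff {f : Pt ι → ℝ} (hf : ContDiff ℝ ∞ f) (x) : DifferentiableAt ℝ f x :=
  (hf.differentiable (by simp)) x

lemma pd_comm {f : Pt ι → ℝ} (hf : ContDiff ℝ ∞ f) (u v : ι) : pd u (pd v f) = pd v (pd u f) := by
  funext x
  have hs : IsSymmSndFDerivAt ℝ f x :=
    (hf.contDiffAt).isSymmSndFDerivAt (by simp; exact WithTop.coe_le_coe.2 (le_top : (2 : ℕ∞) ≤ ⊤))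
  have hd : DifferentiableAt ℝ (fderiv ℝ f) x :=
    ((hf.fderiv_right (m := ∞) (by simp)).differentiable (by simp)) x
  have key : ∀ a b : ι, pd a (pd b f) x
      = fderiv ℝ (fderiv ℝ f) x (Pi.single a 1) (Pi.single b 1) := by
    intro a b
    unfold pd
    rw [fderiv_clm_apply hd (differentiableAt_const _)]
    simp
  rw [key, key, hs.eq]

lemma pd_sum {κ : Type} (s : Finset κ) {f : κ → Pt ι → ℝ} (hf : ∀ a, ContDiff ℝ ∞ (f a))
    (u : ι) (x) : pd u (fun y => ∑ a ∈ s, f a y) x = ∑ a ∈ s, pd u (f a) x := by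
  unfold pd
  rw [fderiv_fun_sum (fun a _ => smooth_diff (hf a) x)]
  simp

lemma pd_cmul {f : Pt ι → ℝ} (hf : ContDiff ℝ ∞ f) (r : ℝ)
    (u : ι) (x) : pd u (fun y => r * f y) x = r * pd u f x := by
  unfold pd
  rw [fderiv_const_mul (smooth_diff hf x)]
  simp

lemma pd_mulc {f : Pt ι → ℝ} (hf : ContDiff ℝ ∞ f) (r : ℝ)
    (u : ι) (x) : pd u (fun y => f y * r) x = pd u f x * r := by
  simp only [mul_comm _ r]
  exact pd_cmul hf r u x

lemma pd_mul {f g : Pt ι → ℝ} (hf : ContDiff ℝ ∞ f) (hg : ContDiff ℝ ∞ g)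
    (u : ι) (x) : pd u (fun y => f y * g y) x = pd u f x * g x + f x * pd u g x := by
  unfold pd
  rw [fderiv_fun_mul (smooth_diff hf x) (smooth_diff hg x)]
  simp; ring

lemma pd_add {f g : Pt ι → ℝ} (hf : ContDiff ℝ ∞ f) (hg : ContDiff ℝ ∞ g)
    (u : ι) (x) : pd u (fun y => f y + g y) x = pd u f x + pd u g x := by
  unfold pd
  rw [fderiv_fun_add (smooth_diff hf x) (smooth_diff hg x)]
  simp

lemma pd_neg {f : Pt ι → ℝ} (u : ι) (x) : pd u (fun y => - f y) x = - pd u f x := by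
  unfold pd
  rw [fderiv_fun_neg]
  simp

lemma Sm.pf {p : ℕ} {w : PForm ι p} (h : Sm w) (u : ι) : Sm (pf u w) :=
  fun idx => pd_smooth (h idx) u

lemma Sm.extd {p : ℕ} {w : PForm ι p} (h : Sm w) : Sm (extd w) := by
  intro idx
  unfold EDS.extd
  exact ContDiff.sum fun k _ => contDiff_const.mul (pd_smooth (h _) _)

lemma Sm.wedge {p q : ℕ} {w : PForm ι p} {η : PForm ι q} (h : Sm w) (h' : Sm η) :
    Sm (wedge w η) := by
  intro idx
  unfold EDS.wedge
  exact contDiff_const.mul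
    (ContDiff.sum fun k _ => contDiff_const.mul ((h _).mul (h' _)))

lemma Sm.cast {p q : ℕ} (e : p = q) {w : PForm ι p} (h : Sm w) : Sm (PForm.cast e w) :=
  fun _ => h _

lemma Sm.add {p : ℕ} {w η : PForm ι p} (h : Sm w) (h' : Sm η) : Sm (w + η) :=
  fun idx => (h idx).add (h' idx)

lemma Sm.neg {p : ℕ} {w : PForm ι p} (h : Sm w) : Sm (-w) := fun idx => (h idx).neg

lemma Sm.smul {p : ℕ} {w : PForm ι p} (h : Sm w) (r : ℝ) : Sm (r • w) :=
  fun idx => contDiff_const.mul (h idx)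

lemma P_extd {p : ℕ} (w : PForm ι p) (x) : P (extd w) x = ∑ u, ev u * P (pf u w) x := by
  unfold P extd
  rw [Psi_sum]
  have : ∀ k : Fin (p+1), Psi (fun idx : Fin (p+1) → ι =>
      (-1 : ℝ) ^ (k : ℕ) * pd (idx k) (w (idx ∘ k.succAbove)) x)
      = ((p+1 : ℕ) : ℝ)⁻¹ • ∑ u, ev u * Psi (fun idx => pf u w idx x) := by
    intro k
    rw [Psi_smul]
    unfold Psi
    rw [← (Fin.insertNthEquiv (fun _ => ι) k).sum_comp, Fintype.sum_prod_type]
    have h1 : ∀ (u : ι) (j : Fin p → ι),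
        Fin.insertNthEquiv (fun _ => ι) k (u, j) = k.insertNth (α := fun _ => ι) u j :=
      fun _ _ => rfl
    have h2 : ∀ (u : ι) (j : Fin p → ι), (k.insertNth (α := fun _ => ι) u j) ∘ k.succAbove = j := by
      intro u j; funext t; simp
    simp only [h1, h2, Fin.insertNth_apply_same, em_insertNth]
    have h3 : ∀ (r : ℝ) (z : EA ι), r • ((-1 : ℝ) ^ (k : ℕ) • z) = (-1 : ℝ) ^ (k : ℕ) • (r • z) :=
      fun r z => smul_comm _ _ _
    simp only [h3]
    simp only [← Finset.smul_sum]
    rw [h3, smul_smul ((-1 : ℝ) ^ (k : ℕ)), ← mul_pow]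
    simp only [mul_smul_comm, Finset.mul_sum, ← Finset.smul_sum, smul_smul]
    rw [Nat.factorial_succ]
    push_cast
    rw [mul_inv]
    simp [pf]
  simp only [this, Finset.sum_const, Finset.card_univ, Fintype.card_fin]
  rw [← Nat.cast_smul_eq_nsmul ℝ, smul_smul, mul_inv_cancel₀, one_smul]
  exact_mod_cast p.succ_ne_zero

lemma wedge_eq_alt {p q : ℕ} (w : PForm ι p) (η : PForm ι q) (x) :
    (fun idx => wedge w η idx x) = fun idx => ((p.factorial * q.factorial : ℕ) : ℝ)⁻¹ *
      alt (fun idx : Fin (p+q) → ι => w (fun i => idx (Fin.castAdd q i)) x *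
        η (fun j => idx (Fin.natAdd p j)) x) idx := rfl

lemma P_wedge {p q : ℕ} (w : PForm ι p) (η : PForm ι q) (x) :
    P (wedge w η) x = P w x * P η x := by
  unfold P
  rw [wedge_eq_alt, Psi_smul, Psi_mul]

lemma AltF_wedge {p q : ℕ} (w : PForm ι p) (η : PForm ι q) : AltF (wedge w η) := by
  intro x
  rw [wedge_eq_alt]
  exact (isAlt_alt _).smul _

lemma AltF.cast {p q : ℕ} (e : p = q) {w : PForm ι p} (h : AltF w) : AltF (PForm.cast e w) :=
  fun x => (h x).cast e

lemma AltF.add {p : ℕ} {w η : PForm ι p} (h : AltF w) (h' : AltF η) : AltF (w + η) :=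
  fun x => (h x).add (h' x)

lemma AltF.neg {p : ℕ} {w : PForm ι p} (h : AltF w) : AltF (-w) := fun x => (h x).neg

lemma AltF.smul {p : ℕ} {w : PForm ι p} (h : AltF w) (r : ℝ) : AltF (r • w) :=
  fun x => (h x).smul r

lemma AltF.pf {p : ℕ} {w : PForm ι p} (h : AltF w) (hs : Sm w) (u : ι) : AltF (pf u w) := by
  intro x idx σ
  have : w (fun t => idx (σ t)) = fun y => ((Equiv.Perm.sign σ : ℤ) : ℝ) * w idx y := by
    funext y; exact h y idx σ
  simp only [EDSaux.pf, this]
  exact pd_cmul (hs idx) _ _ _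

lemma dl_succ {p : ℕ} (u : ι) (j : Fin p → ι) (i : Fin (p+1) → ι) :
    dl (Fin.cons u j : Fin (p+1) → ι) i
      = ∑ k : Fin (p+1), (-1 : ℝ) ^ (k : ℕ) * bv u (i k) * dl j (i ∘ k.succAbove) := by
  unfold dl
  rw [Matrix.det_succ_row_zero]
  rfl

lemma AltF.extd {p : ℕ} {w : PForm ι p} (h : AltF w) (hs : Sm w) : AltF (extd w) := by
  intro x
  have key : (fun idx => EDS.extd w idx x) = fun idx => ∑ u, ∑ j : Fin p → ι,
      ((p.factorial : ℝ)⁻¹ * EDSaux.pf u w j x) * dl (Fin.cons u j : Fin (p+1) → ι) idx := by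
    funext idx
    simp only [dl_succ, Finset.mul_sum]
    unfold EDS.extd
    have h1 : ∀ u, ∀ j : Fin p → ι, EDSaux.pf u w j x =
        (p.factorial : ℝ)⁻¹ * ∑ l, EDSaux.pf u w l x * dl l j := by
      intro u j
      have := alt_of_isAlt (h.pf hs u x) j
      rw [sum_dl (fun l => EDSaux.pf u w l x) j, this, ← mul_assoc, inv_mul_cancel₀, one_mul]
      exact_mod_cast p.factorial_ne_zero
    have h2 : ∀ k : Fin (p+1), (-1 : ℝ) ^ (k : ℕ) * pd (idx k) (w (idx ∘ k.succAbove)) x =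
        ∑ u, ∑ j : Fin p → ι, ((p.factorial : ℝ)⁻¹ * EDSaux.pf u w j x) *
          ((-1 : ℝ) ^ (k : ℕ) * bv u (idx k) * dl j (idx ∘ k.succAbove)) := by
      intro k
      rw [Finset.sum_eq_single (idx k)]
      · have := h1 (idx k) (idx ∘ k.succAbove)
        change _ * EDSaux.pf (idx k) w (idx ∘ k.succAbove) x = _
        rw [this, Finset.mul_sum, Finset.mul_sum]
        refine Finset.sum_congr rfl fun j _ => ?_
        simp [bv]; ring
      · intro b _ hb
        simp [bv, Pi.single_apply, Ne.symm hb]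
      · simp
    simp only [h2]
    rw [Finset.sum_comm]
    refine Finset.sum_congr rfl fun u _ => ?_
    rw [Finset.sum_comm]
  rw [key]
  intro idx σ
  simp only [dl_alt _ idx σ, Finset.mul_sum]
  refine Finset.sum_congr rfl fun u _ => Finset.sum_congr rfl fun j _ => ?_
  ring

lemma form_ext {p : ℕ} {w η : PForm ι p} (h : AltF w) (h' : AltF η)
    (e : ∀ x, P w x = P η x) : w = η := by
  funext idx x
  exact congrFun (Psi_inj (h x) (h' x) (e x)) idx

lemma P_add {p : ℕ} (w η : PForm ι p) (x) : P (w + η) x = P w x + P η x := Psi_add _ _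
lemma P_sub {p : ℕ} (w η : PForm ι p) (x) : P (w - η) x = P w x - P η x := Psi_sub _ _
lemma P_neg {p : ℕ} (w : PForm ι p) (x) : P (-w) x = - P w x := Psi_neg _
lemma P_smul {p : ℕ} (r : ℝ) (w : PForm ι p) (x) : P (r • w) x = r • P w x := Psi_smul _ _
lemma P_cast {p q : ℕ} (e : p = q) (w : PForm ι p) (x) : P (PForm.cast e w) x = P w x :=
  Psi_cast e (fun idx => w idx x)

lemma pf_add {p : ℕ} {w η : PForm ι p} (h : Sm w) (h' : Sm η) (u : ι) :
    pf u (w + η) = pf u w + pf u η := by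
  funext idx x; exact pd_add (h idx) (h' idx) u x
lemma pf_neg {p : ℕ} (w : PForm ι p) (u : ι) : pf u (-w) = - pf u w := by
  funext idx x; exact pd_neg u x
lemma pf_smul {p : ℕ} {w : PForm ι p} (h : Sm w) (r : ℝ) (u : ι) :
    pf u (r • w) = r • pf u w := by
  funext idx x; exact pd_cmul (h idx) r u x
lemma pf_cast {p q : ℕ} (e : p = q) (w : PForm ι p) (u : ι) :
    pf u (PForm.cast e w) = PForm.cast e (pf u w) := rfl

lemma pf_wedge {p q : ℕ} {w : PForm ι p} {η : PForm ι q} (h : Sm w) (h' : Sm η) (u : ι) :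
    pf u (wedge w η) = wedge (pf u w) η + wedge w (pf u η) := by
  funext idx x
  change pd u (wedge w η idx) x = wedge (pf u w) η idx x + wedge w (pf u η) idx x
  unfold wedge
  rw [pd_cmul (ContDiff.sum fun k _ => contDiff_const.mul ((h _).mul (h' _))),
    pd_sum _ (fun k => contDiff_const.mul ((h _).mul (h' _))), ← mul_add, ← Finset.sum_add_distrib]
  congr 1
  refine Finset.sum_congr rfl fun σ _ => ?_
  rw [pd_cmul ((h _).mul (h' _)), pd_mul (h _) (h' _)]
  unfold pf
  ring

lemma pf_extd {p : ℕ} {w : PForm ι p} (h : Sm w) (u : ι) :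
    pf u (extd w) = extd (pf u w) := by
  funext idx x
  change pd u (extd w idx) x = extd (pf u w) idx x
  unfold extd
  rw [pd_sum _ (fun k => contDiff_const.mul (pd_smooth (h _) _))]
  refine Finset.sum_congr rfl fun σ _ => ?_
  rw [pd_cmul (pd_smooth (h _) _), pd_comm (h _)]
  rfl

lemma P_extd_extd {p : ℕ} {w : PForm ι p} (h : Sm w) (x) : P (extd (extd w)) x = 0 := by
  rw [P_extd]
  simp only [pf_extd h, P_extd, Finset.mul_sum, ← mul_assoc]
  set Z := ∑ u, ∑ v, ev u * ev v * P (pf v (pf u w)) x with hZ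
  have : Z = - Z := by
    conv_lhs => rw [hZ, Finset.sum_comm]
    rw [hZ, ← Finset.sum_neg_distrib]
    refine Finset.sum_congr rfl fun u _ => ?_
    rw [← Finset.sum_neg_distrib]
    refine Finset.sum_congr rfl fun v _ => ?_
    have : pf u (pf v w) = pf v (pf u w) := by
      funext idx; exact pd_comm (h idx) u v
    rw [this, ev_swap v u, neg_mul]
  have h2 : (2 : ℝ) • Z = 0 := by
    rw [two_smul]; nth_rewrite 1 [this]; simp
  exact (smul_eq_zero.1 h2).resolve_left (by norm_num)


def Cst {p : ℕ} (w : PForm ι p) : Prop := ∀ idx x, w idx x = w idx 0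

lemma Cst.sm {p : ℕ} {w : PForm ι p} (h : Cst w) : Sm w := by
  intro idx
  have : w idx = fun _ => w idx 0 := funext (h idx)
  rw [this]; exact contDiff_const

lemma Sm.fsmul {p : ℕ} {w : PForm ι p} (h : Sm w) {f : Pt ι → ℝ} (hf : ContDiff ℝ ∞ f) :
    Sm (fsmul f w) := fun idx => hf.mul (h idx)

lemma Sm.sum {p : ℕ} {κ : Type} (s : Finset κ) {w : κ → PForm ι p} (h : ∀ a, Sm (w a)) :
    Sm (∑ a ∈ s, w a) := by
  intro idx
  have : (∑ a ∈ s, w a) idx = fun x => ∑ a ∈ s, w a idx x := by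
    funext x; simp [Finset.sum_apply]
  rw [this]
  exact ContDiff.sum fun a _ => h a idx

lemma pf_sum {p : ℕ} {κ : Type} (s : Finset κ) {w : κ → PForm ι p} (h : ∀ a, Sm (w a)) (u : ι) :
    pf u (∑ a ∈ s, w a) = ∑ a ∈ s, pf u (w a) := by
  funext idx x
  have : (∑ a ∈ s, w a) idx = fun x => ∑ a ∈ s, w a idx x := by
    funext x; simp [Finset.sum_apply]
  unfold pf
  rw [this, pd_sum _ (fun a => h a idx)]
  simp [Finset.sum_apply]

lemma pf_fsmul {p : ℕ} {w : PForm ι p} (h : Cst w) {f : Pt ι → ℝ} (hf : ContDiff ℝ ∞ f) (u : ι) :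
    pf u (fsmul f w) = fsmul (pd u f) w := by
  funext idx x
  have : (fsmul f w) idx = fun x => f x * w idx 0 := by
    funext x; simp [fsmul, h idx x]
  unfold pf
  rw [this, pd_mulc hf]
  simp [fsmul, h idx x]

lemma P_sum {p : ℕ} {κ : Type} (s : Finset κ) (w : κ → PForm ι p) (x) :
    P (∑ a ∈ s, w a) x = ∑ a ∈ s, P (w a) x := by
  unfold P
  simp only [Finset.sum_apply]
  exact Psi_sum _ _

lemma P_fsmul {p : ℕ} (f : Pt ι → ℝ) (w : PForm ι p) (x) :
    P (fsmul f w) x = f x • P w x := Psi_smul _ _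

lemma Cst.wedge {p q : ℕ} {w : PForm ι p} {v : PForm ι q} (h : Cst w) (h' : Cst v) :
    Cst (wedge w v) := by
  intro idx x
  unfold EDS.wedge
  congr 1
  refine Finset.sum_congr rfl fun σ _ => ?_
  rw [h _ x, h' _ x]

lemma Cst.wedgeFam {m : ℕ} {w : Fin m → PForm ι 1} (h : ∀ t, Cst (w t)) :
    Cst (wedgeFam w) := by
  intro idx x
  unfold EDS.wedgeFam
  refine Finset.sum_congr rfl fun σ _ => ?_
  congr 1
  refine Finset.prod_congr rfl fun t _ => ?_
  rw [h t _ x]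

def Xi {n : ℕ} (i : Fin n) : MC n := Sum.inr (Sum.inr i)

lemma dx_apply (n : ℕ) (i : Fin n) (idx x) : dx n i idx x = bv (Xi i) (idx 0) := by
  have h : ∀ u : MC n, pd u (xc n i) x = bv (Xi i) u := by
    intro u
    have : xc n i = (ContinuousLinearMap.proj (R := ℝ) (φ := fun _ : MC n => ℝ) (Xi i)) := rfl
    unfold pd
    rw [this, ContinuousLinearMap.fderiv]
    simp only [ContinuousLinearMap.proj_apply, bv, Pi.single_apply, eq_comm]
  unfold dx extd ofFun
  simp [h]

lemma dx_cst (n : ℕ) (i : Fin n) : Cst (dx n i) := by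
  intro idx x; rw [dx_apply, dx_apply]

lemma P_wedgeFam_dx (n m : ℕ) (k : Fin m → Fin n) (x) :
    P (wedgeFam (fun t => dx n (k t))) x = em (fun t => Xi (k t)) := by
  have : (fun idx => wedgeFam (fun t => dx n (k t)) idx x)
      = alt (fun idx => ∏ t, bv (Xi (k t)) (idx t)) := by
    funext idx
    unfold wedgeFam alt
    simp only [dx_apply]
  unfold P
  rw [this, Psi_alt, Finset.sum_eq_single (fun t => Xi (k t))]
  · simp [bv]
  · intro b _ hb
    obtain ⟨t, ht⟩ := Function.ne_iff.1 hb
    rw [Finset.prod_eq_zero (Finset.mem_univ t), zero_smul]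
    simp [bv, ht]
  · simp

lemma P_dx (n : ℕ) (i : Fin n) (x) : P (dx n i) x = ev (Xi i) := by
  have h := P_wedgeFam_dx n 1 (fun _ => i) x
  have h2 : wedgeFam (fun _ : Fin 1 => dx n i) = dx n i := by
    funext idx y
    unfold wedgeFam
    simp [dx_apply]
  rw [h2] at h
  rw [h, em_succ]; simp [em]

def GF (n : ℕ) (g : Fin n → Fin n → Pt (MC n) → ℝ) : PForm (MC n) 2 :=
  (1/2 : ℝ) • ∑ i, ∑ j, fsmul (g i j) (dx n i ⋏ dx n j)

def GS (n : ℕ) (g : Fin n → Fin n → Pt (MC n) → ℝ) : PForm (MC n) (n - 2) :=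
  ((2 * (n - 2).factorial : ℕ) : ℝ)⁻¹ • ∑ i, ∑ j, ∑ k : Fin (n - 2) → Fin n,
    (etaD i * etaD j * (∏ t, etaD (k t)) * eps (raiseIdx i j k)) •
      fsmul (g i j) (wedgeFam (fun t => dx n (k t)))

lemma GF_sm {n : ℕ} {g : Fin n → Fin n → Pt (MC n) → ℝ} (hg : ∀ i j, ContDiff ℝ ∞ (g i j)) :
    Sm (GF n g) :=
  (Sm.sum _ fun i => Sm.sum _ fun j => ((dx_cst n i).wedge (dx_cst n j)).sm.fsmul (hg i j)).smul _

lemma wf_cst (n m : ℕ) (k : Fin m → Fin n) : Cst (wedgeFam (fun t => dx n (k t))) :=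
  Cst.wedgeFam fun t => dx_cst n (k t)

lemma GS_sm {n : ℕ} {g : Fin n → Fin n → Pt (MC n) → ℝ} (hg : ∀ i j, ContDiff ℝ ∞ (g i j)) :
    Sm (GS n g) :=
  (Sm.sum _ fun i => Sm.sum _ fun j => Sm.sum _ fun k =>
    ((wf_cst n _ k).sm.fsmul (hg i j)).smul _).smul _

lemma pf_GF {n : ℕ} {g : Fin n → Fin n → Pt (MC n) → ℝ} (hg : ∀ i j, ContDiff ℝ ∞ (g i j)) (u) :
    pf u (GF n g) = GF n (fun i j => pd u (g i j)) := by
  have h0 : ∀ i j, Sm (fsmul (g i j) (dx n i ⋏ dx n j)) :=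
    fun i j => ((dx_cst n i).wedge (dx_cst n j)).sm.fsmul (hg i j)
  unfold GF
  rw [pf_smul (Sm.sum _ fun i => Sm.sum _ fun j => h0 i j),
    pf_sum _ (fun i => Sm.sum _ fun j => h0 i j)]
  congr 1
  refine Finset.sum_congr rfl fun i _ => ?_
  rw [pf_sum _ (fun j => h0 i j)]
  refine Finset.sum_congr rfl fun j _ => ?_
  rw [pf_fsmul ((dx_cst n i).wedge (dx_cst n j)) (hg i j)]

lemma pf_GS {n : ℕ} {g : Fin n → Fin n → Pt (MC n) → ℝ} (hg : ∀ i j, ContDiff ℝ ∞ (g i j)) (u) :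
    pf u (GS n g) = GS n (fun i j => pd u (g i j)) := by
  have h0 : ∀ i j (k : Fin (n-2) → Fin n), Sm (fsmul (g i j) (wedgeFam (fun t => dx n (k t)))) :=
    fun i j k => (wf_cst n _ k).sm.fsmul (hg i j)
  unfold GS
  rw [pf_smul (Sm.sum _ fun i => Sm.sum _ fun j => Sm.sum _ fun k => (h0 i j k).smul _),
    pf_sum _ (fun i => Sm.sum _ fun j => Sm.sum _ fun k => (h0 i j k).smul _)]
  congr 1
  refine Finset.sum_congr rfl fun i _ => ?_
  rw [pf_sum _ (fun j => Sm.sum _ fun k => (h0 i j k).smul _)]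
  refine Finset.sum_congr rfl fun j _ => ?_
  rw [pf_sum _ (fun k => (h0 i j k).smul _)]
  refine Finset.sum_congr rfl fun k _ => ?_
  rw [pf_smul (h0 i j k), pf_fsmul (wf_cst n _ k) (hg i j)]

lemma em_eps {n : ℕ} (f : Fin n → Fin n) :
    em (fun t => Xi (f t)) = eps f • em (fun t => Xi (n := n) t) := by
  unfold eps
  split_ifs with h
  · exact em_perm (fun t => Xi (n := n) t) (Equiv.ofBijective f h)
  · rw [zero_smul]
    have hi : ¬ Function.Injective f := fun hi => h (Finite.injective_iff_bijective.1 hi)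
    unfold em
    apply ExteriorAlgebra.ιMulti_eq_zero_of_not_inj
    intro h2
    apply hi
    intro a b hab
    apply h2
    simp only [hab]

lemma em_raise {m : ℕ} (a b : Fin (m+2)) (k : Fin m → Fin (m+2)) :
    ev (Xi a) * ev (Xi b) * em (fun t => Xi (k t))
      = eps (raiseIdx (n := m+2) a b k) • em (fun t => Xi (n := m+2) t) := by
  rw [← em_eps, em_succ, em_succ, mul_assoc]
  rfl

lemma eta_eps {m : ℕ} (i j : Fin (m+2)) (k : Fin m → Fin (m+2)) :
    etaD i * etaD j * (∏ t, etaD (k t)) * eps (raiseIdx (n := m+2) i j k)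
      = (∏ t : Fin (m+2), etaD t) * eps (raiseIdx (n := m+2) i j k) := by
  by_cases h : Function.Bijective (raiseIdx (n := m+2) i j k)
  · congr 1
    rw [← Equiv.prod_comp (Equiv.ofBijective _ h) (fun t => etaD t), Fin.prod_univ_succ,
      Fin.prod_univ_succ, ← mul_assoc]
    rfl
  · rw [eps, dif_neg h, mul_zero, mul_zero]

lemma GF_GS_eq {m : ℕ} (g h : Fin (m+2) → Fin (m+2) → Pt (MC (m+2)) → ℝ) (x y) :
    P (GF (m+2) g) x * P (GS (m+2) h) y =
      ((1/2 : ℝ) * (((2 * m.factorial : ℕ) : ℝ)⁻¹ * ∑ a, ∑ b, ∑ i, ∑ j, ∑ k : Fin m → Fin (m+2),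
        g a b x * h i j y * (∏ t : Fin (m+2), etaD t) * eps (raiseIdx (n := m+2) i j k) *
          eps (raiseIdx (n := m+2) a b k))) • em (fun t => Xi (n := m+2) t) := by
  have e1 : P (GF (m+2) g) x = (1/2 : ℝ) • ∑ a, ∑ b, g a b x • (ev (Xi a) * ev (Xi b)) := by
    unfold GF
    simp only [P_smul, P_sum, P_fsmul, P_wedge, P_dx]
  have e2 : P (GS (m+2) h) y = ((2 * m.factorial : ℕ) : ℝ)⁻¹ • ∑ i, ∑ j, ∑ k : Fin m → Fin (m+2),
      ((∏ t : Fin (m+2), etaD t) * eps (raiseIdx (n := m+2) i j k)) •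
        h i j y • em (fun t => Xi (k t)) := by
    unfold GS
    simp only [P_smul, P_sum, P_fsmul]
    congr 1
    refine Finset.sum_congr rfl fun i _ => Finset.sum_congr rfl fun j _ =>
      Finset.sum_congr rfl fun k _ => ?_
    rw [P_wedgeFam_dx (m+2) (m+2-2) k y]
    congr 1
    exact eta_eps i j k
  rw [e1, e2, smul_mul_smul_comm, mul_smul, mul_smul, mul_smul, Finset.sum_mul]
  congr 2
  simp only [Finset.sum_smul]
  refine Finset.sum_congr rfl fun a _ => ?_
  rw [Finset.sum_mul]
  refine Finset.sum_congr rfl fun b _ => ?_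
  rw [Finset.mul_sum]
  refine Finset.sum_congr rfl fun i _ => ?_
  rw [Finset.mul_sum]
  refine Finset.sum_congr rfl fun j _ => ?_
  rw [Finset.mul_sum]
  refine Finset.sum_congr rfl fun k _ => ?_
  rw [smul_smul, smul_mul_smul_comm, em_raise, smul_smul]
  congr 1
  ring

lemma GF_GS_symm {n : ℕ} (hn : 3 ≤ n) (g h : Fin n → Fin n → Pt (MC n) → ℝ) (x) :
    P (GF n g) x * P (GS n h) x = P (GF n h) x * P (GS n g) x := by
  obtain ⟨m, rfl⟩ : ∃ m, n = m + 2 := ⟨n - 2, by omega⟩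
  rw [GF_GS_eq, GF_GS_eq]
  congr 3
  have swap4 : ∀ f : Fin (m+2) → Fin (m+2) → Fin (m+2) → Fin (m+2) → ℝ,
      ∑ a, ∑ b, ∑ i, ∑ j, f a b i j = ∑ a, ∑ b, ∑ i, ∑ j, f i j a b := by
    intro f
    have := Finset.sum_comm (s := (Finset.univ : Finset (Fin (m+2) × Fin (m+2))))
      (t := (Finset.univ : Finset (Fin (m+2) × Fin (m+2)))) (f := fun p q => f p.1 p.2 q.1 q.2)
    simpa only [Fintype.sum_prod_type] using this
  rw [swap4]
  refine Finset.sum_congr rfl fun a _ => Finset.sum_congr rfl fun b _ =>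
    Finset.sum_congr rfl fun i _ => Finset.sum_congr rfl fun j _ => Finset.sum_congr rfl fun k _ => ?_
  ring

lemma coord_smooth (n : ℕ) (c : MC n) : ContDiff ℝ ∞ (fun m : Pt (MC n) => m c) :=
  contDiff_apply ℝ ℝ c

lemma Fc_smooth (n : ℕ) (i j : Fin n) : ContDiff ℝ ∞ (Fc n i j) := by
  unfold Fc
  split_ifs
  · exact coord_smooth _ _
  · exact (coord_smooth _ _).neg
  · exact contDiff_const

lemma Aform_sm (n : ℕ) : Sm (Aform n) :=
  Sm.sum _ fun i => (dx_cst n i).sm.fsmul (coord_smooth n _)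

lemma Fform_sm (n : ℕ) : Sm (Fform n) := GF_sm (Fc_smooth n)
lemma starF_sm (n : ℕ) : Sm (starF n) := GS_sm (Fc_smooth n)

lemma key {n : ℕ} (hn : 3 ≤ n) (u x) :
    P (pf u (Fform n)) x * P (starF n) x = P (Fform n) x * P (pf u (starF n)) x := by
  have h1 : Fform n = GF n (Fc n) := rfl
  have h2 : starF n = GS n (Fc n) := rfl
  rw [h1, h2, pf_GF (Fc_smooth n), pf_GS (Fc_smooth n)]
  exact GF_GS_symm hn _ _ x

lemma P_two_ev (w : PForm ι 2) (x) (u : ι) : P w x * ev u = ev u * P w x := Psi_two_ev _ _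
lemma P_two_comm (w : PForm ι 2) {q : ℕ} (v : PForm ι q) (x) : P w x * P v x = P v x * P w x :=
  Psi_two_comm _ _

lemma main1 (n : ℕ) (hn : 3 ≤ n) (q1 : n - 2 + (1 + 1) = n) (q2 : 2 + (n - 2) = n)
    (q3 : 2 + (n - 2 + 1) = n + 1) :
    extd (PForm.cast q1 (-(starF n ⋏ extd (Aform n))) +
        PForm.cast q2 ((1/2 : ℝ) • (Fform n ⋏ starF n))) =
      PForm.cast q3
        ((extd (Aform n) - Fform n) ⋏ (-(extd (starF n)))) := by
  have sA := Aform_sm n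
  have sF := Fform_sm n
  have sS := starF_sm n
  have s1 : Sm (starF n ⋏ extd (Aform n)) := sS.wedge sA.extd
  have s2 : Sm (Fform n ⋏ starF n) := sF.wedge sS
  refine form_ext (AltF.extd (AltF.add (AltF.cast _ (AltF_wedge _ _).neg)
      (AltF.cast _ ((AltF_wedge _ _).smul _))) ((s1.neg.cast _).add ((s2.smul _).cast _)))
    (AltF.cast _ (AltF_wedge _ _)) fun x => ?_
  rw [P_extd, P_cast, P_wedge, P_neg, P_sub, P_extd (starF n)]
  have hu : ∀ u, P (pf u (PForm.cast q1
        (-(starF n ⋏ extd (Aform n))) +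
        PForm.cast q2 ((1/2 : ℝ) • (Fform n ⋏ starF n)))) x =
      - (P (extd (Aform n)) x * P (pf u (starF n)) x + P (pf u (extd (Aform n))) x * P (starF n) x)
        + P (Fform n) x * P (pf u (starF n)) x := by
    intro u
    rw [pf_add (s1.neg.cast _) ((s2.smul _).cast _), pf_cast, pf_cast, pf_neg, pf_smul s2,
      pf_wedge sS sA.extd, pf_wedge sF sS]
    rw [P_add, P_cast, P_cast, P_neg, P_smul, P_add, P_add, P_wedge, P_wedge, P_wedge, P_wedge,
      key hn, ← two_smul ℝ (P (Fform n) x * _), smul_smul]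
    rw [P_two_comm (extd (Aform n)), P_two_comm (pf u (extd (Aform n)))]
    norm_num
  simp only [hu]
  have hdd := P_extd_extd sA x
  rw [P_extd] at hdd
  have e : ∀ u, ev u * (- (P (extd (Aform n)) x * P (pf u (starF n)) x +
      P (pf u (extd (Aform n))) x * P (starF n) x) + P (Fform n) x * P (pf u (starF n)) x) =
      (P (extd (Aform n)) x - P (Fform n) x) * -(ev u * P (pf u (starF n)) x)
        - ev u * P (pf u (extd (Aform n))) x * P (starF n) x := by
    intro u
    have c1 := P_two_ev (extd (Aform n)) x u
    have c2 := P_two_ev (Fform n) x u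
    rw [mul_neg, sub_mul, ← mul_assoc (P (extd (Aform n)) x), c1, ← mul_assoc (P (Fform n) x), c2]
    noncomm_ring
  simp only [e]
  rw [Finset.sum_sub_distrib, ← Finset.sum_mul, hdd, zero_mul, sub_zero, ← Finset.mul_sum,
    Finset.sum_neg_distrib]

lemma main2 (n : ℕ) (hn : 3 ≤ n) (q1 : n - 2 + (1 + 1) = n) (q2 : 2 + (n - 2) = n)
    (q3 : 2 + (n - 2 + 1) = n + 1) :
    extd ((extd (Aform n) - Fform n) ⋏ (-(extd (starF n)))) = 0 := by
  have sA := Aform_sm n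
  have sF := Fform_sm n
  have sS := starF_sm n
  have s1 : Sm (starF n ⋏ extd (Aform n)) := sS.wedge sA.extd
  have s2 : Sm (Fform n ⋏ starF n) := sF.wedge sS
  have s3 : Sm (extd (Aform n) - Fform n) := by
    rw [sub_eq_add_neg]; exact sA.extd.add sF.neg
  refine form_ext (AltF.extd (AltF_wedge _ _) (s3.wedge sS.extd.neg)) ?_ fun x => ?_
  · intro x idx σ; simp
  have h := P_extd_extd ((s1.neg.cast q1).add
    ((s2.smul (1/2)).cast q2)) x
  rw [main1 n hn q1 q2 q3, P_extd] at h
  simp only [pf_cast, P_cast] at h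
  rw [P_extd, h]
  exact Psi_zero.symm

end EDSaux

theorem stmt5 (n : ℕ) (hn : 3 ≤ n) :
    extd (PForm.cast (show n - 2 + (1 + 1) = n by omega) (-(starF n ⋏ extd (Aform n))) +
        PForm.cast (show 2 + (n - 2) = n by omega) ((1/2 : ℝ) • (Fform n ⋏ starF n))) =
      PForm.cast (show 2 + (n - 2 + 1) = n + 1 by omega)
        ((extd (Aform n) - Fform n) ⋏ (-(extd (starF n)))) ∧
    extd ((extd (Aform n) - Fform n) ⋏ (-(extd (starF n)))) = 0 := 
  ⟨EDSaux.main1 n hn _ _ _, EDSaux.main2 n hn (by omega) (by omega) (by omega)⟩
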